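/- arXiv:1604.02568 — 6 statements merged into one kernel-verified Lean document; each statement's English description precedes it below -/
import Mathlib

section
/- For all 0 ≤ i < j ≤ n and 0 ≤ k < l ≤ n, the Frobenius inner product satisfies T_{i,j} : N_{k,l} = δ_{ik} δ_{jl}; that is, T_{i,j} : N_{i,j} = 1 and T_{i,j} : N_{k,l} = 0 whenever {i,j} ≠ {k,l}. -/
open Matrix

open Matrix

/-- The unit tangent vector of the edge `x i x j`: `t_{i,j} = (x j - x i)/‖x j - x i‖`
(Euclidean norm expressed via the dot product). -/
noncomputable def edgeTangent {n : ℕ} (x : Fin (n + 1) → (Fin n → ℝ)) (i j : Fin (n + 1)) :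
    Fin n → ℝ :=
  (Real.sqrt ((x j - x i) ⬝ᵥ (x j - x i)))⁻¹ • (x j - x i)

/-- `T_{i,j} = t_{i,j} t_{i,j}ᵀ`. -/
noncomputable def Tmat {n : ℕ} (x : Fin (n + 1) → (Fin n → ℝ)) (i j : Fin (n + 1)) :
    Matrix (Fin n) (Fin n) ℝ :=
  vecMulVec (edgeTangent x i j) (edgeTangent x i j)

/-- `N_{i,j} = (ν_i ν_jᵀ + ν_j ν_iᵀ) / (2 (ν_iᵀ t_{i,j}) (ν_jᵀ t_{i,j}))`. -/
noncomputable def Nmat {n : ℕ} (x : Fin (n + 1) → (Fin n → ℝ))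
    (ν : Fin (n + 1) → (Fin n → ℝ)) (i j : Fin (n + 1)) : Matrix (Fin n) (Fin n) ℝ :=
  (2 * (ν i ⬝ᵥ edgeTangent x i j) * (ν j ⬝ᵥ edgeTangent x i j))⁻¹ •
    (vecMulVec (ν i) (ν j) + vecMulVec (ν j) (ν i))

/-- The Frobenius inner product `A : B = Σ_{p,q} A_{pq} B_{pq}`. -/
noncomputable def frob {n : ℕ} (A B : Matrix (Fin n) (Fin n) ℝ) : ℝ :=
  ∑ p, ∑ q, A p q * B p q

theorem frob_vecMulVec_vecMulVec {n : ℕ} (a b u v : Fin n → ℝ) :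
    frob (vecMulVec a b) (vecMulVec u v) = (u ⬝ᵥ a) * (v ⬝ᵥ b) := by
  simp only [frob, vecMulVec_apply, dotProduct, Finset.sum_mul_sum]
  exact Finset.sum_congr rfl fun p _ => Finset.sum_congr rfl fun q _ => by ring

theorem frob_add_right {n : ℕ} (A B C : Matrix (Fin n) (Fin n) ℝ) :
    frob A (B + C) = frob A B + frob A C := by
  simp [frob, mul_add, Finset.sum_add_distrib]

theorem frob_smul_right {n : ℕ} (c : ℝ) (A B : Matrix (Fin n) (Fin n) ℝ) :
    frob A (c • B) = c * frob A B := by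
  simp [frob, Finset.mul_sum, mul_left_comm]

theorem frob_Tmat_Nmat {n : ℕ} (x ν : Fin (n + 1) → (Fin n → ℝ)) (i j k l : Fin (n + 1)) :
    frob (Tmat x i j) (Nmat x ν k l) =
      (2 * (ν k ⬝ᵥ edgeTangent x k l) * (ν l ⬝ᵥ edgeTangent x k l))⁻¹ *
        (2 * (ν k ⬝ᵥ edgeTangent x i j) * (ν l ⬝ᵥ edgeTangent x i j)) := by
  rw [Tmat, Nmat, frob_smul_right, frob_add_right, frob_vecMulVec_vecMulVec,
    frob_vecMulVec_vecMulVec]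
  ring

/-- A face normal is orthogonal to the edges of its face. -/
theorem dotProduct_edgeTangent_eq_zero {n : ℕ} {x : Fin (n + 1) → (Fin n → ℝ)}
    {v : Fin n → ℝ} {m i j : Fin (n + 1)}
    (hv : ∀ k l, k ≠ m → l ≠ m → v ⬝ᵥ (x k - x l) = 0) (hi : i ≠ m) (hj : j ≠ m) :
    v ⬝ᵥ edgeTangent x i j = 0 := by
  rw [edgeTangent, dotProduct_smul, hv j i hj hi, smul_zero]

/-- A vector orthogonal to all edges of a nondegenerate simplex vanishes. -/
theorem AffineIndependent.dotProduct_self_eq_zero {n : ℕ} {x : Fin (n + 1) → (Fin n → ℝ)}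
    (hx : AffineIndependent ℝ x) {v : Fin n → ℝ} (hv : ∀ k l, v ⬝ᵥ (x k - x l) = 0) :
    v ⬝ᵥ v = 0 := by
  have hspan : vectorSpan ℝ (Set.range x) = ⊤ :=
    hx.vectorSpan_eq_top_of_card_eq_finrank_add_one (by simp)
  have hle : vectorSpan ℝ (Set.range x) ≤ LinearMap.ker (dotProductBilin ℝ ℝ v) := by
    rw [vectorSpan_def, Submodule.span_le]
    rintro _ ⟨_, ⟨k, rfl⟩, _, ⟨l, rfl⟩, rfl⟩
    exact hv k l
  exact hle (hspan ▸ Submodule.mem_top : v ∈ vectorSpan ℝ (Set.range x))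

/-- A face normal is transversal to the edges leaving the face. -/
theorem AffineIndependent.dotProduct_sub_ne_zero {n : ℕ} {x : Fin (n + 1) → (Fin n → ℝ)}
    (hx : AffineIndependent ℝ x) {v : Fin n → ℝ} {i j : Fin (n + 1)} (hunit : v ⬝ᵥ v = 1)
    (hv : ∀ k l, k ≠ i → l ≠ i → v ⬝ᵥ (x k - x l) = 0) (hij : j ≠ i) :
    v ⬝ᵥ (x j - x i) ≠ 0 := by
  intro h0
  have hconst (k : Fin (n + 1)) : v ⬝ᵥ x k = v ⬝ᵥ x i := by
    rw [dotProduct_sub, sub_eq_zero] at h0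
    by_cases hk : k = i
    · rw [hk]
    · have hkj := hv k j hk hij
      rw [dotProduct_sub, sub_eq_zero] at hkj
      rw [hkj, h0]
  have hzero := hx.dotProduct_self_eq_zero (v := v) fun k l => by
    rw [dotProduct_sub, hconst k, hconst l, sub_self]
  exact one_ne_zero (hunit.symm.trans hzero)

theorem dotProduct_edgeTangent_ne_zero {n : ℕ} {x : Fin (n + 1) → (Fin n → ℝ)}
    {v : Fin n → ℝ} {i j : Fin (n + 1)} (h : v ⬝ᵥ (x j - x i) ≠ 0) :
    v ⬝ᵥ edgeTangent x i j ≠ 0 := by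
  have hne : x j - x i ≠ 0 := fun h0 => h (by rw [h0, dotProduct_zero])
  have hpos : 0 < (x j - x i) ⬝ᵥ (x j - x i) :=
    lt_of_le_of_ne (Finset.sum_nonneg fun _ _ => mul_self_nonneg _)
      fun h0 => hne (dotProduct_self_eq_zero.mp h0.symm)
  rw [edgeTangent, dotProduct_smul, smul_eq_mul]
  exact mul_ne_zero (inv_ne_zero (Real.sqrt_pos.mpr hpos).ne') h

/-- Duality: `T_{i,j} : N_{k,l} = δ_{ik} δ_{jl}` for `i < j`, `k < l`. -/
theorem statement2 {n : ℕ} (hn : 1 ≤ n) (x : Fin (n + 1) → (Fin n → ℝ))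
    (hx : AffineIndependent ℝ x)
    (ν : Fin (n + 1) → (Fin n → ℝ))
    (hνunit : ∀ i, ν i ⬝ᵥ ν i = 1)
    (hνorth : ∀ i k l, k ≠ i → l ≠ i → ν i ⬝ᵥ (x k - x l) = 0)
    (i j k l : Fin (n + 1)) (hij : i < j) (hkl : k < l) :
    frob (Tmat x i j) (Nmat x ν k l) = if i = k ∧ j = l then 1 else 0 := by
  rw [frob_Tmat_Nmat]
  split_ifs with h
  · obtain ⟨rfl, rfl⟩ := h
    have hi : ν i ⬝ᵥ edgeTangent x i j ≠ 0 :=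
      dotProduct_edgeTangent_ne_zero
        (hx.dotProduct_sub_ne_zero (hνunit i) (hνorth i) hij.ne')
    have hj : ν j ⬝ᵥ edgeTangent x i j ≠ 0 := by
      refine dotProduct_edgeTangent_ne_zero ?_
      rw [← neg_sub, dotProduct_neg, neg_ne_zero]
      exact hx.dotProduct_sub_ne_zero (hνunit j) (hνorth j) hij.ne
    exact inv_mul_cancel₀ (mul_ne_zero (mul_ne_zero two_ne_zero hi) hj)
  · have hcases : (i ≠ k ∧ j ≠ k) ∨ (i ≠ l ∧ j ≠ l) := by omega
    rcases hcases with ⟨hi, hj⟩ | ⟨hi, hj⟩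
    · rw [dotProduct_edgeTangent_eq_zero (hνorth k) hi hj, mul_zero, zero_mul, mul_zero]
    · rw [dotProduct_edgeTangent_eq_zero (hνorth l) hi hj, mul_zero, mul_zero]
end

section
/- The family of the (n+1)n/2 symmetric tensors (T_{i,j})_{0 ≤ i < j ≤ n} is a basis of the real vector space of symmetric n×n real matrices: it is linearly independent and every symmetric n×n real matrix is a real linear combination of the T_{i,j}. -/
open Matrix

/-- Twice the sum of a symmetric function over the pairs `i < j` is its double sum, when it
vanishes on the diagonal. -/
theorem two_nsmul_sum_lt {ι M : Type*} [Fintype ι] [LinearOrder ι] [AddCommMonoid M]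
    (f : ι → ι → M) (hsymm : ∀ i j, f i j = f j i) (hdiag : ∀ i, f i i = 0) :
    2 • ∑ p : {p : ι × ι // p.1 < p.2}, f p.1.1 p.1.2 = ∑ i, ∑ j, f i j := by
  have hsub : ∑ p : {p : ι × ι // p.1 < p.2}, f p.1.1 p.1.2
      = ∑ i, ∑ j, if i < j then f i j else 0 := by
    rw [← Fintype.sum_prod_type' (f := fun i j => if i < j then f i j else 0),
      ← Finset.sum_filter]
    exact (Finset.sum_subtype _ (by simp) fun p : ι × ι => f p.1 p.2).symm
  rw [two_nsmul]
  nth_rewrite 2 [hsub]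
  rw [Finset.sum_comm, hsub, ← Finset.sum_add_distrib]
  refine Finset.sum_congr rfl fun i _ => ?_
  rw [← Finset.sum_add_distrib]
  refine Finset.sum_congr rfl fun j _ => ?_
  rcases lt_trichotomy i j with h | rfl | h
  · simp [h, h.not_gt]
  · simp [hdiag]
  · simp [h, h.not_gt, hsymm j i]

theorem card_pairs_lt (n : ℕ) :
    Fintype.card {p : Fin (n + 1) × Fin (n + 1) // p.1 < p.2} = (n + 1) * n / 2 := by
  have h := two_nsmul_sum_lt (fun i j : Fin (n + 1) => if i = j then 0 else 1)
    (fun i j => by simp [eq_comm]) (by simp)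
  have hone : ∑ p : {p : Fin (n + 1) × Fin (n + 1) // p.1 < p.2},
      (if p.1.1 = p.1.2 then 0 else 1)
        = Fintype.card {p : Fin (n + 1) × Fin (n + 1) // p.1 < p.2} := by
    rw [Fintype.card_eq_sum_ones]
    exact Finset.sum_congr rfl fun p _ => if_neg p.2.ne
  have hrow (i : Fin (n + 1)) : ∑ j, (if i = j then 0 else 1) = n := by
    rw [← Finset.sum_erase_add _ _ (Finset.mem_univ i),
      Finset.sum_congr rfl fun j hj => if_neg (Finset.ne_of_mem_erase hj).symm]
    simp
  simp only [hone, hrow, Finset.sum_const, Finset.card_univ, Fintype.card_fin,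
    smul_eq_mul] at h
  omega

/-- The gradients of the barycentric coordinates of a nondegenerate simplex. -/
theorem exists_barycentric_gradients {n : ℕ} (x : Fin (n + 1) → (Fin n → ℝ))
    (hx : AffineIndependent ℝ x) :
    ∃ g : Fin (n + 1) → (Fin n → ℝ),
      (∀ k i j, g k ⬝ᵥ (x j - x i) = (if k = j then 1 else 0) - (if k = i then 1 else 0)) ∧
      ∑ k, g k = 0 ∧ (Matrix.of x)ᵀ * Matrix.of g = 1 := by
  have hspan : affineSpan ℝ (Set.range x) = ⊤ :=
    hx.affineSpan_eq_top_iff_card_eq_finrank_add_one.mpr (by simp)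
  let b : AffineBasis (Fin (n + 1)) ℝ (Fin n → ℝ) := ⟨x, hx, hspan⟩
  have hlin (k : Fin (n + 1)) (v w : Fin n → ℝ) :
      (b.coord k).linear (v - w) = b.coord k v - b.coord k w :=
    (b.coord k).linearMap_vsub v w
  have hlin0 (k : Fin (n + 1)) (v : Fin n → ℝ) :
      (b.coord k).linear v = b.coord k v - b.coord k 0 := by
    rw [← hlin, sub_zero]
  refine ⟨fun k a => (b.coord k).linear (Pi.single a 1), fun k i j => ?_, ?_, ?_⟩
  · have hdot (v : Fin n → ℝ) :
        (fun a => (b.coord k).linear (Pi.single a 1)) ⬝ᵥ v = (b.coord k).linear v := by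
      conv_rhs => rw [pi_eq_sum_univ' v, map_sum]
      refine Finset.sum_congr rfl fun a _ => ?_
      rw [map_smul, smul_eq_mul, mul_comm]
    rw [hdot, hlin]
    exact congrArg₂ (· - ·) (b.coord_apply k j) (b.coord_apply k i)
  · ext a
    rw [Finset.sum_apply, Pi.zero_apply]
    simp only [hlin0]
    rw [Finset.sum_sub_distrib, b.sum_coord_apply_eq_one, b.sum_coord_apply_eq_one, sub_self]
  · ext a c
    have h1 := congrFun (b.linear_combination_coord_eq_self (Pi.single c 1)) a
    have h0 := congrFun (b.linear_combination_coord_eq_self 0) a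
    simp only [Finset.sum_apply, Pi.smul_apply, smul_eq_mul] at h1 h0
    simp only [mul_apply, transpose_apply, of_apply, hlin0, mul_sub, Finset.sum_sub_distrib]
    simp only [mul_comm (x _ a)]
    refine (congrArg₂ (· - ·) h1 h0).trans ?_
    simp [Pi.single_apply, one_apply]

/-- The congruence of a symmetric matrix with zero row sums, written with differences of rows. -/
theorem transpose_mul_mul_eq_neg_sum_lt {ι m : Type*} [Fintype ι] [LinearOrder ι]
    (x : ι → m → ℝ) (A : Matrix ι ι ℝ) (hA : A.IsSymm) (hsum : ∀ i, ∑ j, A i j = 0) :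
    (Matrix.of x)ᵀ * A * Matrix.of x
      = ∑ p : {p : ι × ι // p.1 < p.2},
          (-A p.1.1 p.1.2) • vecMulVec (x p.1.2 - x p.1.1) (x p.1.2 - x p.1.1) := by
  have hsymm (i j : ι) : A i j = A j i := hA.apply j i
  ext a c
  have h := two_nsmul_sum_lt (fun i j => -A i j * ((x j a - x i a) * (x j c - x i c)))
    (fun i j => by rw [hsymm i j]; ring) (by simp)
  have hrow (u : ι → ℝ) : ∑ i, ∑ j, A i j * u i = 0 := by
    simp [← Finset.sum_mul, hsum]
  have hcol (u : ι → ℝ) : ∑ i, ∑ j, A i j * u j = 0 := by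
    rw [Finset.sum_comm, ← hrow u]
    simp only [hsymm]
  have hswap : ∑ i, ∑ j, A i j * (x j a * x i c) = ∑ i, ∑ j, A i j * (x i a * x j c) := by
    rw [Finset.sum_comm]
    refine Finset.sum_congr rfl fun i _ => Finset.sum_congr rfl fun j _ => ?_
    rw [hsymm]
  have hexp : ∑ i, ∑ j, -A i j * ((x j a - x i a) * (x j c - x i c))
      = 2 * ∑ i, ∑ j, A i j * (x i a * x j c) := by
    calc _ = ∑ i, ∑ j, A i j * (x i a * x j c) + ∑ i, ∑ j, A i j * (x j a * x i c)
          - ∑ i, ∑ j, A i j * (x i a * x i c) - ∑ i, ∑ j, A i j * (x j a * x j c) := by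
            simp only [← Finset.sum_add_distrib, ← Finset.sum_sub_distrib]
            refine Finset.sum_congr rfl fun i _ => Finset.sum_congr rfl fun j _ => ?_
            ring
      _ = _ := by
            rw [hswap, hrow fun i => x i a * x i c, hcol fun i => x i a * x i c]
            ring
  have hlhs : ((Matrix.of x)ᵀ * A * Matrix.of x) a c
      = ∑ i, ∑ j, A i j * (x i a * x j c) := by
    simp only [mul_apply, transpose_apply, of_apply, Finset.sum_mul]
    rw [Finset.sum_comm]
    refine Finset.sum_congr rfl fun i _ => Finset.sum_congr rfl fun j _ => ?_
    ring
  rw [hlhs]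
  simp only [Matrix.sum_apply, Matrix.smul_apply, vecMulVec_apply, Pi.sub_apply, smul_eq_mul]
  rw [nsmul_eq_mul, Nat.cast_ofNat, hexp] at h
  linarith

theorem Tmat_eq_smul_vecMulVec {n : ℕ} (x : Fin (n + 1) → (Fin n → ℝ)) (i j : Fin (n + 1)) :
    Tmat x i j = ((x j - x i) ⬝ᵥ (x j - x i))⁻¹ • vecMulVec (x j - x i) (x j - x i) := by
  have h : 0 ≤ (x j - x i) ⬝ᵥ (x j - x i) :=
    Finset.sum_nonneg fun a _ => mul_self_nonneg _
  rw [Tmat, edgeTangent, smul_vecMulVec, vecMulVec_smul, smul_smul, ← mul_inv,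
    Real.mul_self_sqrt h]

/-- The `(n+1)n/2` symmetric tensors `(T_{i,j})_{0 ≤ i < j ≤ n}` form a basis of the space
of symmetric `n×n` real matrices: the family is linearly independent, and every symmetric
matrix is a real linear combination of the `T_{i,j}`. -/
theorem statement3 {n : ℕ} (hn : 1 ≤ n) (x : Fin (n + 1) → (Fin n → ℝ))
    (hx : AffineIndependent ℝ x) :
    Fintype.card {p : Fin (n + 1) × Fin (n + 1) // p.1 < p.2} = (n + 1) * n / 2 ∧
    LinearIndependent ℝ
      (fun p : {p : Fin (n + 1) × Fin (n + 1) // p.1 < p.2} => Tmat x p.1.1 p.1.2) ∧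
    ∀ σ : Matrix (Fin n) (Fin n) ℝ, σ.IsSymm →
      ∃ c : {p : Fin (n + 1) × Fin (n + 1) // p.1 < p.2} → ℝ,
        σ = ∑ p : {p : Fin (n + 1) × Fin (n + 1) // p.1 < p.2}, c p • Tmat x p.1.1 p.1.2 := by
  obtain ⟨g, hg, hgsum, hxg⟩ := exists_barycentric_gradients x hx
  have hlen (p : {p : Fin (n + 1) × Fin (n + 1) // p.1 < p.2}) :
      (x p.1.2 - x p.1.1) ⬝ᵥ (x p.1.2 - x p.1.1) ≠ 0 := fun h =>
    p.2.ne' (hx.injective (sub_eq_zero.mp (dotProduct_self_eq_zero.mp h)))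
  refine ⟨card_pairs_lt n, ?_, fun σ hσ => ?_⟩
  · rw [Fintype.linearIndependent_iff]
    intro c hc q
    have h := congrArg (fun M : Matrix (Fin n) (Fin n) ℝ => g q.1.1 ⬝ᵥ (M *ᵥ g q.1.2)) hc
    simp only [Tmat_eq_smul_vecMulVec, sum_mulVec, smul_mulVec, vecMulVec_mulVec,
      dotProduct_sum, dotProduct_smul, zero_mulVec, dotProduct_zero, smul_eq_mul,
      op_smul_eq_smul] at h
    simp only [dotProduct_comm _ (g q.1.2), hg] at h
    rw [Finset.sum_eq_single q] at h
    · have hne := q.2.ne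
      have hne' := q.2.ne'
      simp only [hne, hne', if_true, if_false, mul_eq_zero, inv_eq_zero, hlen q] at h
      simpa using h
    · rintro ⟨⟨i, j⟩, hij⟩ - hne
      obtain ⟨⟨k, l⟩, hkl⟩ := q
      simp only [ne_eq, Subtype.mk.injEq, Prod.mk.injEq, not_and] at hne hij hkl ⊢
      split_ifs <;> grind
    · simp
  · let A : Matrix (Fin (n + 1)) (Fin (n + 1)) ℝ := Matrix.of g * σ * (Matrix.of g)ᵀ
    have hA : A.IsSymm := by
      simp only [A, Matrix.IsSymm, transpose_mul, transpose_transpose, hσ.eq, Matrix.mul_assoc]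
    have hAsum (i : Fin (n + 1)) : ∑ j, A i j = 0 := by
      simp only [A, mul_apply (M := Matrix.of g * σ), transpose_apply, of_apply]
      rw [Finset.sum_comm]
      refine Finset.sum_eq_zero fun a _ => ?_
      have := congrFun hgsum a
      rw [Finset.sum_apply] at this
      rw [← Finset.mul_sum, this, Pi.zero_apply, mul_zero]
    have hgx : (Matrix.of g)ᵀ * Matrix.of x = 1 := by
      rw [← transpose_transpose (Matrix.of x), ← transpose_mul, hxg, transpose_one]
    have hσA : (Matrix.of x)ᵀ * A * Matrix.of x = σ := by
      calc _ = ((Matrix.of x)ᵀ * Matrix.of g) * σ * ((Matrix.of g)ᵀ * Matrix.of x) := by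
            simp only [A, Matrix.mul_assoc]
        _ = σ := by rw [hxg, hgx, Matrix.one_mul, Matrix.mul_one]
    refine ⟨fun p => -A p.1.1 p.1.2 * ((x p.1.2 - x p.1.1) ⬝ᵥ (x p.1.2 - x p.1.1)), ?_⟩
    rw [← hσA, transpose_mul_mul_eq_neg_sum_lt x A hA hAsum]
    refine Finset.sum_congr rfl fun p _ => ?_
    rw [Tmat_eq_smul_vecMulVec, smul_smul, mul_assoc, mul_inv_cancel₀ (hlen p), mul_one]
end

section
/- The family of the (n+1)n/2 symmetric tensors (N_{i,j})_{0 ≤ i < j ≤ n} is a basis of the real vector space of symmetric n×n real matrices: it is linearly independent and every symmetric n×n real matrix is a real linear combination of the N_{i,j}. -/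
open Matrix

open Matrix

theorem card_fin_pairs_lt (m : ℕ) :
    Fintype.card {p : Fin m × Fin m // p.1 < p.2} = m * (m - 1) / 2 := by
  rw [Fintype.card_subtype, Finset.card_filter, Fintype.sum_prod_type_right]
  simp only [← Finset.card_filter]
  rw [← Finset.sum_range_id, ← Fin.sum_univ_eq_sum_range (fun i => i)]
  refine Finset.sum_congr rfl fun j _ => ?_
  rw [Finset.filter_gt_eq_Iio, Fin.card_Iio]

theorem AffineIndependent.span_range_sub_eq_top {n : ℕ} {x : Fin (n + 1) → (Fin n → ℝ)}
    (hx : AffineIndependent ℝ x) (i : Fin (n + 1)) :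
    Submodule.span ℝ (Set.range fun k => x k - x i) = ⊤ := by
  have h : affineSpan ℝ (Set.range x) = ⊤ := by
    rw [hx.affineSpan_eq_top_iff_card_eq_finrank_add_one]
    simp
  have h2 := AffineSubspace.vectorSpan_eq_top_of_affineSpan_eq_top ℝ _ _ h
  rwa [vectorSpan_range_eq_span_range_vsub_right ℝ x i] at h2

/-- The quadratic form `A ↦ vᵀ A v`, as a linear functional of the matrix `A`. -/
noncomputable def quadEval {n : ℕ} (v : Fin n → ℝ) : Matrix (Fin n) (Fin n) ℝ →ₗ[ℝ] ℝ where
  toFun A := v ⬝ᵥ A *ᵥ v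
  map_add' A B := by rw [add_mulVec, dotProduct_add]
  map_smul' c A := by rw [smul_mulVec, dotProduct_smul, RingHom.id_apply]

theorem quadEval_apply {n : ℕ} (v : Fin n → ℝ) (A : Matrix (Fin n) (Fin n) ℝ) :
    quadEval v A = v ⬝ᵥ A *ᵥ v := rfl

theorem quadEval_smul_left {n : ℕ} (c : ℝ) (v : Fin n → ℝ) (A : Matrix (Fin n) (Fin n) ℝ) :
    quadEval (c • v) A = c * c * quadEval v A := by
  simp only [quadEval_apply, mulVec_smul, dotProduct_smul, smul_dotProduct, smul_eq_mul]
  ring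

theorem quadEval_Nmat {n : ℕ} (x ν : Fin (n + 1) → (Fin n → ℝ)) (i j : Fin (n + 1))
    (v : Fin n → ℝ) :
    quadEval v (Nmat x ν i j) =
      (2 * (ν i ⬝ᵥ edgeTangent x i j) * (ν j ⬝ᵥ edgeTangent x i j))⁻¹ *
        (2 * (ν i ⬝ᵥ v) * (ν j ⬝ᵥ v)) := by
  simp only [Nmat, map_smul, map_add, quadEval_apply, vecMulVec_mulVec, smul_eq_mul]
  simp only [op_smul_eq_smul, smul_dotProduct, smul_eq_mul, dotProduct_comm v]
  ring

theorem Nmat_isSymm {n : ℕ} (x ν : Fin (n + 1) → (Fin n → ℝ)) (i j : Fin (n + 1)) :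
    (Nmat x ν i j).IsSymm := by
  simp [Matrix.IsSymm, Nmat, transpose_vecMulVec, add_comm]

/-- A symmetric matrix is determined by its quadratic form on the edges of a simplex. -/
theorem Matrix.IsSymm.eq_zero_of_quadEval_edges {n : ℕ} {x : Fin (n + 1) → (Fin n → ℝ)}
    (hx : AffineIndependent ℝ x) {A : Matrix (Fin n) (Fin n) ℝ} (hA : A.IsSymm)
    (h : ∀ i j, i < j → quadEval (x j - x i) A = 0) : A = 0 := by
  have hall : ∀ i j, quadEval (x j - x i) A = 0 := by
    intro i j
    rcases lt_trichotomy i j with hij | rfl | hij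
    · exact h i j hij
    · simp [quadEval_apply]
    · rw [← neg_sub, ← neg_one_smul ℝ, quadEval_smul_left, h j i hij, mul_zero]
  have hsymm : ∀ u v : Fin n → ℝ, u ⬝ᵥ A *ᵥ v = v ⬝ᵥ A *ᵥ u := by
    intro u v
    rw [dotProduct_mulVec, ← mulVec_transpose, hA.eq, dotProduct_comm]
  have hedge : ∀ k l, (x k - x 0) ⬝ᵥ A *ᵥ (x l - x 0) = 0 := by
    intro k l
    have hk := hall 0 k
    have hl := hall 0 l
    have hkl := hall l k
    rw [← sub_sub_sub_cancel_right (x k) (x l) (x 0)] at hkl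
    simp only [quadEval_apply, mulVec_sub (A := A) (x k - x 0), dotProduct_sub,
      sub_dotProduct (x k - x 0)] at hk hl hkl
    have hs := hsymm (x k - x 0) (x l - x 0)
    linarith
  have hspan := hx.span_range_sub_eq_top 0
  have hright : ∀ k v, (x k - x 0) ⬝ᵥ A *ᵥ v = 0 := by
    intro k v
    have hv : v ∈ Submodule.span ℝ (Set.range fun k => x k - x 0) := hspan ▸ Submodule.mem_top
    induction hv using Submodule.span_induction with
    | mem v hv => obtain ⟨l, rfl⟩ := hv; exact hedge k l
    | zero => simp
    | add u v _ _ hu hv => rw [mulVec_add, dotProduct_add, hu, hv, add_zero]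
    | smul c v _ hv => rw [mulVec_smul, dotProduct_smul, hv, smul_zero]
  have hzero : ∀ u v, u ⬝ᵥ A *ᵥ v = 0 := by
    intro u v
    have hu : u ∈ Submodule.span ℝ (Set.range fun k => x k - x 0) := hspan ▸ Submodule.mem_top
    induction hu using Submodule.span_induction with
    | mem u hu => obtain ⟨k, rfl⟩ := hu; exact hright k v
    | zero => simp
    | add u w _ _ hu hw => rw [add_dotProduct, hu, hw, add_zero]
    | smul c u _ hu => rw [smul_dotProduct, hu, smul_zero]
  ext p q
  simpa using hzero (Pi.single p 1) (Pi.single q 1)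

theorem faceNormal_dotProduct_edge_ne_zero {n : ℕ} {x : Fin (n + 1) → (Fin n → ℝ)}
    (hx : AffineIndependent ℝ x) {i j : Fin (n + 1)} (hij : j ≠ i) {u : Fin n → ℝ}
    (hu : u ⬝ᵥ u = 1) (horth : ∀ k l, k ≠ i → l ≠ i → u ⬝ᵥ (x k - x l) = 0) :
    u ⬝ᵥ (x j - x i) ≠ 0 := by
  intro h0
  have hedge : ∀ k, u ⬝ᵥ (x k - x i) = 0 := by
    intro k
    by_cases hk : k = i
    · simp [hk]
    · rw [← sub_add_sub_cancel (x k) (x j) (x i), dotProduct_add, horth k j hk hij, h0, add_zero]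
  have hzero : ∀ v, u ⬝ᵥ v = 0 := by
    intro v
    have hv : v ∈ Submodule.span ℝ (Set.range fun k => x k - x i) :=
      hx.span_range_sub_eq_top i ▸ Submodule.mem_top
    induction hv using Submodule.span_induction with
    | mem v hv => obtain ⟨k, rfl⟩ := hv; exact hedge k
    | zero => simp
    | add v w _ _ hv hw => rw [dotProduct_add, hv, hw, add_zero]
    | smul c v _ hv => rw [dotProduct_smul, hv, smul_zero]
  exact one_ne_zero (hu.symm.trans (hzero u))

theorem exists_edgeTangent_eq_smul {n : ℕ} {x : Fin (n + 1) → (Fin n → ℝ)}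
    (hx : AffineIndependent ℝ x) {i j : Fin (n + 1)} (hij : i ≠ j) :
    ∃ s : ℝ, s ≠ 0 ∧ edgeTangent x i j = s • (x j - x i) := by
  refine ⟨_, inv_ne_zero (Real.sqrt_ne_zero'.2 ?_), rfl⟩
  have hne : x j - x i ≠ 0 := sub_ne_zero.2 fun h => hij (hx.injective h).symm
  refine lt_of_le_of_ne (Finset.sum_nonneg fun p _ => mul_self_nonneg _) ?_
  exact fun h => hne (dotProduct_self_eq_zero.1 h.symm)

/-- The quadratic forms along the edge tangents are dual to the tensors `N_{i,j}`. -/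
theorem quadEval_edgeTangent_Nmat {n : ℕ} {x ν : Fin (n + 1) → (Fin n → ℝ)}
    (hx : AffineIndependent ℝ x) (hνunit : ∀ i, ν i ⬝ᵥ ν i = 1)
    (hνorth : ∀ i k l, k ≠ i → l ≠ i → ν i ⬝ᵥ (x k - x l) = 0)
    (p q : {p : Fin (n + 1) × Fin (n + 1) // p.1 < p.2}) :
    quadEval (edgeTangent x p.1.1 p.1.2) (Nmat x ν q.1.1 q.1.2) = if p = q then 1 else 0 := by
  obtain ⟨⟨k, l⟩, hkl⟩ := p
  obtain ⟨⟨i, j⟩, hij⟩ := q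
  dsimp only at hkl hij ⊢
  obtain ⟨s, hs, ht⟩ := exists_edgeTangent_eq_smul hx hkl.ne
  rw [quadEval_Nmat]
  split_ifs with h
  · obtain ⟨rfl, rfl⟩ : k = i ∧ l = j := by simpa using h
    have h1 := faceNormal_dotProduct_edge_ne_zero hx hkl.ne' (hνunit k) (hνorth k)
    have h2 := faceNormal_dotProduct_edge_ne_zero hx hkl.ne (hνunit l) (hνorth l)
    rw [← neg_sub, dotProduct_neg, neg_ne_zero] at h2
    refine inv_mul_cancel₀ ?_
    simp only [ht, dotProduct_smul, smul_eq_mul]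
    positivity
  · have hend : ∀ m, m ≠ k → m ≠ l → ν m ⬝ᵥ edgeTangent x k l = 0 := by
      intro m hk hl
      rw [ht, dotProduct_smul, hνorth m l k hl.symm hk.symm, smul_zero]
    have hcase : (i ≠ k ∧ i ≠ l) ∨ (j ≠ k ∧ j ≠ l) := by
      simp only [Subtype.mk.injEq, Prod.mk.injEq] at h
      grind
    rcases hcase with ⟨h1, h2⟩ | ⟨h1, h2⟩
    · rw [hend i h1 h2]; simp
    · rw [hend j h1 h2]; simp

/-- The `(n+1)n/2` symmetric tensors `(N_{i,j})_{0 ≤ i < j ≤ n}` form a basis of the space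
of symmetric `n×n` real matrices: the family is linearly independent, and every symmetric
matrix is a real linear combination of the `N_{i,j}`. -/
theorem statement4 {n : ℕ} (hn : 1 ≤ n) (x : Fin (n + 1) → (Fin n → ℝ))
    (hx : AffineIndependent ℝ x)
    (ν : Fin (n + 1) → (Fin n → ℝ))
    (hνunit : ∀ i, ν i ⬝ᵥ ν i = 1)
    (hνorth : ∀ i k l, k ≠ i → l ≠ i → ν i ⬝ᵥ (x k - x l) = 0) :
    Fintype.card {p : Fin (n + 1) × Fin (n + 1) // p.1 < p.2} = (n + 1) * n / 2 ∧
    LinearIndependent ℝ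
      (fun p : {p : Fin (n + 1) × Fin (n + 1) // p.1 < p.2} => Nmat x ν p.1.1 p.1.2) ∧
    ∀ σ : Matrix (Fin n) (Fin n) ℝ, σ.IsSymm →
      ∃ c : {p : Fin (n + 1) × Fin (n + 1) // p.1 < p.2} → ℝ,
        σ = ∑ p : {p : Fin (n + 1) × Fin (n + 1) // p.1 < p.2}, c p • Nmat x ν p.1.1 p.1.2 := by
  have hdual := quadEval_edgeTangent_Nmat hx hνunit hνorth
  refine ⟨by simpa using card_fin_pairs_lt (n + 1), ?_, fun σ hσ => ?_⟩
  · rw [Fintype.linearIndependent_iff]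
    intro c hc p
    simpa [map_sum, hdual] using congrArg (quadEval (edgeTangent x p.1.1 p.1.2)) hc
  · refine ⟨fun p => quadEval (edgeTangent x p.1.1 p.1.2) σ, sub_eq_zero.1 ?_⟩
    refine Matrix.IsSymm.eq_zero_of_quadEval_edges hx (hσ.sub ?_) fun i j hij => ?_
    · rw [Matrix.IsSymm, transpose_sum]
      exact Finset.sum_congr rfl fun p _ => (Nmat_isSymm x ν p.1.1 p.1.2).smul _
    · obtain ⟨s, hs, ht⟩ := exists_edgeTangent_eq_smul hx hij.ne
      have h := hdual ⟨(i, j), hij⟩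
      dsimp only at h
      refine (mul_eq_zero.1 ?_).resolve_left (mul_ne_zero hs hs)
      rw [← quadEval_smul_left, ← ht]
      simp [map_sum, h]
end

section
/- Every symmetric n×n real matrix σ admits the dual-basis expansions σ = Σ_{0 ≤ i < j ≤ n} (σ : N_{i,j}) T_{i,j} and σ = Σ_{0 ≤ i < j ≤ n} (σ : T_{i,j}) N_{i,j}. -/
open Matrix

open Matrix

/-- The edge vectors at any vertex of a nondegenerate simplex span the ambient space. -/
theorem eq_zero_of_dotProduct_edge_eq_zero {n : ℕ} {x : Fin (n + 1) → (Fin n → ℝ)}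
    (hx : AffineIndependent ℝ x) {v : Fin n → ℝ} (hv : ∀ k l, v ⬝ᵥ (x k - x l) = 0) :
    v = 0 := by
  have hspan : vectorSpan ℝ (Set.range x) = ⊤ :=
    hx.vectorSpan_eq_top_of_card_eq_finrank_add_one (by simp)
  have hle : vectorSpan ℝ (Set.range x) ≤ LinearMap.ker (dotProductBilin ℝ ℝ v) := by
    rw [vectorSpan_def, Submodule.span_le]
    rintro _ ⟨_, ⟨k, rfl⟩, _, ⟨l, rfl⟩, rfl⟩
    exact hv k l
  have hmem : v ∈ LinearMap.ker (dotProductBilin ℝ ℝ v) := hle (hspan ▸ Submodule.mem_top)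
  exact dotProduct_self_eq_zero.mp hmem

/-- The unit face normals are multiples of the gradients of the barycentric coordinates. -/
theorem exists_barycentric_gradient {n : ℕ} {x : Fin (n + 1) → (Fin n → ℝ)}
    (hx : AffineIndependent ℝ x) {ν : Fin (n + 1) → (Fin n → ℝ)}
    (hνunit : ∀ i, ν i ⬝ᵥ ν i = 1)
    (hνorth : ∀ i k l, k ≠ i → l ≠ i → ν i ⬝ᵥ (x k - x l) = 0) :
    ∃ (h : Fin (n + 1) → ℝ) (g : Fin (n + 1) → (Fin n → ℝ)),
      (∀ i, h i ≠ 0) ∧ (∀ i, ν i = h i • g i) ∧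
      ∀ i j k, g i ⬝ᵥ (x j - x k) = (if i = j then 1 else 0) - (if i = k then 1 else 0) := by
  have key : ∀ i, ∃ c : ℝ, c ≠ 0 ∧ ∀ k, k ≠ i → ν i ⬝ᵥ (x i - x k) = c := by
    intro i
    by_contra! hcon
    refine one_ne_zero (α := ℝ) ?_
    rw [← hνunit i, dotProduct_self_eq_zero]
    have hedge : ∀ k, ν i ⬝ᵥ (x i - x k) = 0 := by
      intro k
      by_contra hk
      obtain ⟨l, hl, hne⟩ := hcon _ hk
      have hki : k ≠ i := by rintro rfl; simp at hk
      have := hνorth i k l hki hl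
      simp only [dotProduct_sub] at this hne
      exact hne (by linarith)
    refine eq_zero_of_dotProduct_edge_eq_zero hx fun k l ↦ ?_
    have hk := hedge k
    have hl := hedge l
    simp only [dotProduct_sub] at hk hl ⊢
    linarith
  choose h hne hh using key
  refine ⟨h, fun i ↦ (h i)⁻¹ • ν i, hne, fun i ↦ (smul_inv_smul₀ (hne i) _).symm,
    fun i j k ↦ ?_⟩
  rw [smul_dotProduct, smul_eq_mul]
  have hi := hne i
  by_cases hj : i = j <;> by_cases hk : i = k
  · subst hj; subst hk; simp
  · subst hj
    rw [hh i k (Ne.symm hk)]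
    simp [hk, hi]
  · subst hk
    rw [← neg_sub, dotProduct_neg, hh i j (Ne.symm hj)]
    simp [hj, hi]
  · rw [hνorth i j k (Ne.symm hj) (Ne.symm hk)]
    simp [hj, hk]

/-- The barycentric gradients sum to zero. -/
theorem sum_barycentric_gradient {n : ℕ} {x g : Fin (n + 1) → (Fin n → ℝ)}
    (hx : AffineIndependent ℝ x)
    (hg : ∀ i j k, g i ⬝ᵥ (x j - x k) = (if i = j then 1 else 0) - (if i = k then 1 else 0)) :
    ∑ i, g i = 0 :=
  eq_zero_of_dotProduct_edge_eq_zero hx fun k l ↦ by simp [sum_dotProduct, hg, -dotProduct_sub]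

theorem sum_vertex_mul_barycentric_gradient {n : ℕ} {x g : Fin (n + 1) → (Fin n → ℝ)}
    (hx : AffineIndependent ℝ x)
    (hg : ∀ i j k, g i ⬝ᵥ (x j - x k) = (if i = j then 1 else 0) - (if i = k then 1 else 0))
    (p q : Fin n) : ∑ i, x i p * g i q = if p = q then 1 else 0 := by
  have hzero : ∑ i, x i p • g i - Pi.single p 1 = 0 := by
    refine eq_zero_of_dotProduct_edge_eq_zero hx fun k l ↦ ?_
    simp [sub_dotProduct, sum_dotProduct, smul_dotProduct, hg, mul_sub, -dotProduct_sub]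
  have := congrFun (sub_eq_zero.mp hzero) q
  simpa [Finset.sum_apply, Pi.single_apply, eq_comm] using this

theorem sum_gradient_mul_edge {n : ℕ} {x g : Fin (n + 1) → (Fin n → ℝ)}
    (hx : AffineIndependent ℝ x)
    (hg : ∀ i j k, g i ⬝ᵥ (x j - x k) = (if i = j then 1 else 0) - (if i = k then 1 else 0))
    (a b p q : Fin n) :
    ∑ i, ∑ j, g i a * g j b * ((x j p - x i p) * (x j q - x i q)) =
      -((if p = a then 1 else 0) * (if q = b then 1 else 0) +
        (if p = b then 1 else 0) * (if q = a then 1 else 0)) := by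
  have hsum : ∀ c, ∑ i, g i c = 0 := fun c ↦ by
    simpa using congrFun (sum_barycentric_gradient hx hg) c
  have hdual := sum_vertex_mul_barycentric_gradient hx hg
  calc
    _ = (∑ i, g i a) * (∑ j, x j p * x j q * g j b)
        + (∑ i, x i p * x i q * g i a) * (∑ j, g j b)
        - ((∑ i, x i p * g i a) * (∑ j, x j q * g j b)
          + (∑ i, x i q * g i a) * (∑ j, x j p * g j b)) := by
      simp only [Finset.sum_mul_sum, ← Finset.sum_add_distrib, ← Finset.sum_sub_distrib]
      refine Finset.sum_congr rfl fun i _ ↦ Finset.sum_congr rfl fun j _ ↦ ?_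
      ring
    _ = _ := by
      simp only [hsum, hdual]
      ring

theorem sum_lt_add_swap {ι M : Type*} [Fintype ι] [LinearOrder ι] [AddCommMonoid M]
    (F : ι → ι → M) (hF : ∀ i, F i i = 0) :
    ∑ p : {p : ι × ι // p.1 < p.2}, (F p.1.1 p.1.2 + F p.1.2 p.1.1) = ∑ i, ∑ j, F i j := by
  have hsub : ∑ p : {p : ι × ι // p.1 < p.2}, (F p.1.1 p.1.2 + F p.1.2 p.1.1) =
      ∑ p : ι × ι with p.1 < p.2, (F p.1 p.2 + F p.2 p.1) :=
    (Finset.sum_subtype _ (by simp) fun p : ι × ι ↦ F p.1 p.2 + F p.2 p.1).symm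
  rw [hsub, ← Fintype.sum_prod_type', Finset.sum_add_distrib, Finset.sum_filter,
    Finset.sum_filter, ← (Equiv.prodComm ι ι).sum_comp
      (fun p : ι × ι ↦ if p.1 < p.2 then F p.2 p.1 else 0), ← Finset.sum_add_distrib]
  refine Finset.sum_congr rfl fun ⟨i, j⟩ _ ↦ ?_
  rcases lt_trichotomy i j with h | rfl | h
  · simp [h, h.not_gt]
  · simp [hF]
  · simp [h, h.not_gt]

theorem Nmat_apply_mul_Tmat_apply {n : ℕ} {x ν g : Fin (n + 1) → (Fin n → ℝ)}
    (hx : AffineIndependent ℝ x) {h : Fin (n + 1) → ℝ} (hh : ∀ i, h i ≠ 0)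
    (hν : ∀ i, ν i = h i • g i)
    (hg : ∀ i j k, g i ⬝ᵥ (x j - x k) = (if i = j then 1 else 0) - (if i = k then 1 else 0))
    {i j : Fin (n + 1)} (hij : i ≠ j) (a b p q : Fin n) :
    Nmat x ν i j a b * Tmat x i j p q =
      -(1 / 2) * (g i a * g j b * ((x j p - x i p) * (x j q - x i q)) +
        g j a * g i b * ((x i p - x j p) * (x i q - x j q))) := by
  have hpos : 0 < Real.sqrt ((x j - x i) ⬝ᵥ (x j - x i)) := by
    refine Real.sqrt_pos.mpr (lt_of_le_of_ne ?_ ?_)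
    · exact Finset.sum_nonneg fun k _ ↦ mul_self_nonneg _
    · rw [ne_comm, Ne, dotProduct_self_eq_zero, sub_eq_zero]
      exact fun he ↦ hij (hx.injective he).symm
  have hi := hh i
  have hj := hh j
  simp only [Nmat, Tmat, edgeTangent, Matrix.smul_apply, Matrix.add_apply, vecMulVec_apply,
    hν, dotProduct_smul, smul_dotProduct, hg, smul_eq_mul, Pi.smul_apply, Pi.sub_apply,
    hij, hij.symm, if_true, if_false]
  generalize Real.sqrt ((x j - x i) ⬝ᵥ (x j - x i)) = L at hpos ⊢
  have hL := hpos.ne'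
  field_simp
  ring

/-- The families `N` and `T` reproduce the projection onto symmetric matrices. -/
theorem sum_Nmat_mul_Tmat {n : ℕ} {x ν : Fin (n + 1) → (Fin n → ℝ)}
    (hx : AffineIndependent ℝ x) (hνunit : ∀ i, ν i ⬝ᵥ ν i = 1)
    (hνorth : ∀ i k l, k ≠ i → l ≠ i → ν i ⬝ᵥ (x k - x l) = 0) (a b p q : Fin n) :
    ∑ r : {p : Fin (n + 1) × Fin (n + 1) // p.1 < p.2},
        Nmat x ν r.1.1 r.1.2 a b * Tmat x r.1.1 r.1.2 p q =
      1 / 2 * ((if p = a then 1 else 0) * (if q = b then 1 else 0) +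
        (if p = b then 1 else 0) * (if q = a then 1 else 0)) := by
  obtain ⟨h, g, hh, hν, hg⟩ := exists_barycentric_gradient hx hνunit hνorth
  rw [Finset.sum_congr rfl fun r _ ↦
      Nmat_apply_mul_Tmat_apply hx hh hν hg (ne_of_lt r.2) a b p q, ← Finset.mul_sum,
    sum_lt_add_swap (fun i j ↦ g i a * g j b * ((x j p - x i p) * (x j q - x i q))) (by simp),
    sum_gradient_mul_edge hx hg]
  ring

/-- Two families reproducing the projection onto symmetric matrices expand every symmetric
matrix. -/
theorem eq_sum_frob_smul {n : ℕ} {κ : Type*} [Fintype κ] (A B : κ → Matrix (Fin n) (Fin n) ℝ)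
    (hAB : ∀ a b p q, ∑ r, A r a b * B r p q =
      1 / 2 * ((if p = a then 1 else 0) * (if q = b then 1 else 0) +
        (if p = b then 1 else 0) * (if q = a then 1 else 0)))
    {σ : Matrix (Fin n) (Fin n) ℝ} (hσ : σ.IsSymm) :
    σ = ∑ r, frob σ (A r) • B r := by
  ext p q
  symm
  calc
    (∑ r, frob σ (A r) • B r) p q = ∑ a, ∑ b, σ a b * ∑ r, A r a b * B r p q := by
      simp only [Matrix.sum_apply, Matrix.smul_apply, smul_eq_mul, frob, Finset.sum_mul,
        Finset.mul_sum]
      rw [Finset.sum_comm]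
      refine Finset.sum_congr rfl fun a _ ↦ ?_
      rw [Finset.sum_comm]
      simp only [mul_assoc]
    _ = 1 / 2 * (σ p q + σ q p) := by
      simp only [hAB, mul_add, Finset.sum_add_distrib]
      simp [mul_comm]
    _ = σ p q := by
      rw [hσ.apply p q]
      ring

/-- Dual-basis expansions: every symmetric matrix `σ` satisfies
`σ = Σ_{i<j} (σ : N_{i,j}) T_{i,j}` and `σ = Σ_{i<j} (σ : T_{i,j}) N_{i,j}`. -/
theorem statement5 {n : ℕ} (hn : 1 ≤ n) (x : Fin (n + 1) → (Fin n → ℝ))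
    (hx : AffineIndependent ℝ x)
    (ν : Fin (n + 1) → (Fin n → ℝ))
    (hνunit : ∀ i, ν i ⬝ᵥ ν i = 1)
    (hνorth : ∀ i k l, k ≠ i → l ≠ i → ν i ⬝ᵥ (x k - x l) = 0)
    (σ : Matrix (Fin n) (Fin n) ℝ) (hσ : σ.IsSymm) :
    σ = ∑ p : {p : Fin (n + 1) × Fin (n + 1) // p.1 < p.2},
          frob σ (Nmat x ν p.1.1 p.1.2) • Tmat x p.1.1 p.1.2 ∧
    σ = ∑ p : {p : Fin (n + 1) × Fin (n + 1) // p.1 < p.2},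
          frob σ (Tmat x p.1.1 p.1.2) • Nmat x ν p.1.1 p.1.2 := by
  have hNT := sum_Nmat_mul_Tmat hx hνunit hνorth
  refine ⟨eq_sum_frob_smul _ _ hNT hσ, eq_sum_frob_smul _ _ (fun a b p q ↦ ?_) hσ⟩
  simp only [mul_comm (Tmat _ _ _ _ _), hNT]
  simp only [eq_comm, mul_comm]
end

section
/- Let M be an m×m symmetric positive definite real matrix, C a k×k symmetric positive semidefinite real matrix, and B a k×m real matrix whose transpose Bᵀ is injective (i.e. Bᵀ y = 0 implies y = 0). Then the saddle point matrix [[M, Bᵀ],[B, −C]] is invertible. -/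
open Matrix

/-- The saddle point matrix `[[M, Bᵀ],[B, −C]]` is invertible whenever `M` is SPD,
`C` is symmetric positive semidefinite and `Bᵀ` is injective. -/
theorem statement12 {m k : ℕ} (M : Matrix (Fin m) (Fin m) ℝ) (hM : M.PosDef)
    (C : Matrix (Fin k) (Fin k) ℝ) (hC : C.PosSemidef)
    (B : Matrix (Fin k) (Fin m) ℝ) (hB : ∀ y : Fin k → ℝ, Bᵀ *ᵥ y = 0 → y = 0) :
    IsUnit (fromBlocks M Bᵀ B (-C)).det := by
  rw [isUnit_iff_ne_zero]
  intro hdet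
  obtain ⟨v, hv, hker⟩ := exists_mulVec_eq_zero_iff.mpr hdet
  obtain ⟨x, y, rfl⟩ : ∃ x y, v = Sum.elim x y := ⟨_, _, (Sum.elim_comp_inl_inr v).symm⟩
  rw [fromBlocks_mulVec] at hker
  have h₁ : M *ᵥ x + Bᵀ *ᵥ y = 0 := funext fun i ↦ congrFun hker (Sum.inl i)
  have h₂ : B *ᵥ x + -C *ᵥ y = 0 := funext fun i ↦ congrFun hker (Sum.inr i)
  rw [neg_mulVec, ← sub_eq_add_neg, sub_eq_zero] at h₂
  have hx : x = 0 := by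
    by_contra hx
    have hpos := hM.dotProduct_mulVec_pos hx
    have hnonneg := hC.dotProduct_mulVec_nonneg y
    rw [star_trivial] at hpos hnonneg
    rw [eq_neg_of_add_eq_zero_left h₁, dotProduct_neg, dotProduct_mulVec, vecMul_transpose, h₂,
      dotProduct_comm] at hpos
    linarith
  subst hx
  have hy : y = 0 := hB y (by simpa using h₁)
  subst hy
  exact hv Sum.elim_zero_zero
end

section
/- (Additive auxiliary space preconditioner.) Fix positive real constants c₁, c₂, c₃, c₄, c₅, c₆, c₇. Then there exists a constant 𝒞 > 0 depending only on c₁, …, c₇ with the following property. Let V and W be finite-dimensional real inner product spaces, let S on V, A on W, and R on V be symmetric positive definite linear operators, let 𝔅 on W be a symmetric linear operator, let Π : W → V and P : V → W be linear maps, and let ρ > 0. Assume: (i) ⟨Sv, v⟩ ≤ ρ‖v‖² for all v ∈ V; (ii) ⟨Sv, v⟩ ≤ c₁⟨R⁻¹v, v⟩ and ⟨R⁻¹v, v⟩ ≤ c₂ ρ ‖v‖² for all v ∈ V; (iii) c₃⟨Aw, w⟩ ≤ ⟨𝔅Aw, Aw⟩ and ⟨𝔅Aw, Aw⟩ ≤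 c₄⟨Aw, w⟩ for all w ∈ W; (iv) ⟨SΠw, Πw⟩ ≤ c₅⟨Aw, w⟩ for all w ∈ W; (v) ⟨APv, Pv⟩ ≤ c₆⟨Sv, v⟩ and ‖v − ΠPv‖² ≤ c₇ ρ⁻¹ ⟨Sv, v⟩ for all v ∈ V. Then the operator X := R + Π 𝔅 Πᵗ is symmetric positive definite, and there exists γ > 0 such that γ⟨Xv, v⟩ ≤ ⟨S⁻¹v, v⟩ ≤ 𝒞 γ⟨Xv, v⟩ for all v ∈ V; equivalently, the condition number of the preconditioned operator satisfies κ(XS) ≤ 𝒞. -/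
open RealInnerProductSpace

section QuadraticForm

variable {E : Type*} [NormedAddCommGroup E] [InnerProductSpace ℝ E]

/-- Young's inequality for the form of a symmetric positive semidefinite operator. -/
theorem LinearMap.IsSymmetric.inner_le_of_inner_self_le {T : E →ₗ[ℝ] E} (hT : T.IsSymmetric)
    (hpos : ∀ x, 0 ≤ ⟪T x, x⟫) {k s : ℝ} (hk : 0 < k) {x y : E} (hy : ⟪T y, y⟫ ≤ k * s) :
    ⟪T x, y⟫ ≤ k * ⟪T x, x⟫ + s / 4 := by
  have h := hpos ((2 * k) • x - y)
  have hxy : ⟪T y, x⟫ = ⟪T x, y⟫ := by rw [hT y x, real_inner_comm]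
  simp only [map_sub, map_smul, inner_sub_left, inner_sub_right, real_inner_smul_left,
    real_inner_smul_right, hxy] at h
  refine le_of_mul_le_mul_left ?_ hk
  linarith

theorem LinearMap.IsSymmetric.inner_le_of_inner_self_le_inner {T : E →ₗ[ℝ] E}
    (hT : T.IsSymmetric) (hpos : ∀ x, 0 ≤ ⟪T x, x⟫) {c : ℝ} (hc : 0 < c) {x y : E}
    (hy : ⟪T y, y⟫ ≤ c * ⟪T x, y⟫) :
    ⟪T x, y⟫ ≤ c * ⟪T x, x⟫ := by
  have := hT.inner_le_of_inner_self_le hpos (half_pos hc) (s := 2 * ⟪T x, y⟫) (x := x) (y := y)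
    (by linarith)
  linarith

theorem inner_map_self_nonneg_of_pos {T : E →ₗ[ℝ] E} (hpos : ∀ x, x ≠ 0 → 0 < ⟪T x, x⟫)
    (x : E) : 0 ≤ ⟪T x, x⟫ := by
  rcases eq_or_ne x 0 with rfl | hx
  · simp
  · exact (hpos x hx).le

theorem LinearMap.surjective_of_inner_map_self_pos [FiniteDimensional ℝ E] {T : E →ₗ[ℝ] E}
    (hpos : ∀ x, x ≠ 0 → 0 < ⟪T x, x⟫) : Function.Surjective T := by
  refine LinearMap.injective_iff_surjective.mp ((injective_iff_map_eq_zero T).mpr fun x hx => ?_)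
  by_contra hne
  simpa [hx] using hpos x hne

end QuadraticForm

/-- Additive auxiliary space preconditioner (Xu's framework): under assumptions (i)–(v),
the operator `X = R + Π 𝔅 Πᵗ` is symmetric positive definite and the condition number of
the preconditioned operator `X S` is bounded by a constant `𝒞` depending only on the
constants `c₁, …, c₇`, i.e. there is `γ > 0` with
`γ⟨Xv,v⟩ ≤ ⟨S⁻¹v,v⟩ ≤ 𝒞 γ⟨Xv,v⟩` for all `v`. -/
theorem statement13 (c₁ c₂ c₃ c₄ c₅ c₆ c₇ : ℝ)
    (hc₁ : 0 < c₁) (hc₂ : 0 < c₂) (hc₃ : 0 < c₃) (hc₄ : 0 < c₄)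
    (hc₅ : 0 < c₅) (hc₆ : 0 < c₆) (hc₇ : 0 < c₇) :
    ∃ 𝒞 : ℝ, 0 < 𝒞 ∧
      ∀ (V W : Type)
        [NormedAddCommGroup V] [InnerProductSpace ℝ V] [FiniteDimensional ℝ V]
        [NormedAddCommGroup W] [InnerProductSpace ℝ W] [FiniteDimensional ℝ W]
        (S Rop Rinv Sinv : V →ₗ[ℝ] V) (A 𝔅 : W →ₗ[ℝ] W)
        (Pr : W →ₗ[ℝ] V) (P : V →ₗ[ℝ] W) (ρ : ℝ),
        0 < ρ →
        -- S, A, R symmetric positive definite, 𝔅 symmetric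
        S.IsSymmetric → (∀ v : V, v ≠ 0 → 0 < ⟪S v, v⟫) →
        A.IsSymmetric → (∀ w : W, w ≠ 0 → 0 < ⟪A w, w⟫) →
        Rop.IsSymmetric → (∀ v : V, v ≠ 0 → 0 < ⟪Rop v, v⟫) →
        𝔅.IsSymmetric →
        -- R⁻¹ and S⁻¹
        Rinv ∘ₗ Rop = LinearMap.id → Rop ∘ₗ Rinv = LinearMap.id →
        Sinv ∘ₗ S = LinearMap.id → S ∘ₗ Sinv = LinearMap.id →
        -- (i)
        (∀ v : V, ⟪S v, v⟫ ≤ ρ * ‖v‖ ^ 2) →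
        -- (ii)
        (∀ v : V, ⟪S v, v⟫ ≤ c₁ * ⟪Rinv v, v⟫) →
        (∀ v : V, ⟪Rinv v, v⟫ ≤ c₂ * ρ * ‖v‖ ^ 2) →
        -- (iii)
        (∀ w : W, c₃ * ⟪A w, w⟫ ≤ ⟪𝔅 (A w), A w⟫) →
        (∀ w : W, ⟪𝔅 (A w), A w⟫ ≤ c₄ * ⟪A w, w⟫) →
        -- (iv) stability of Π
        (∀ w : W, ⟪S (Pr w), Pr w⟫ ≤ c₅ * ⟪A w, w⟫) →
        -- (v) stability of P and approximability
        (∀ v : V, ⟪A (P v), P v⟫ ≤ c₆ * ⟪S v, v⟫) →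
        (∀ v : V, ‖v - Pr (P v)‖ ^ 2 ≤ c₇ * ρ⁻¹ * ⟪S v, v⟫) →
        -- conclusion for X = R + Π 𝔅 Πᵗ
        (Rop + Pr ∘ₗ 𝔅 ∘ₗ LinearMap.adjoint Pr).IsSymmetric ∧
        (∀ v : V, v ≠ 0 → 0 < ⟪(Rop + Pr ∘ₗ 𝔅 ∘ₗ LinearMap.adjoint Pr) v, v⟫) ∧
        ∃ γ : ℝ, 0 < γ ∧ ∀ v : V,
          γ * ⟪(Rop + Pr ∘ₗ 𝔅 ∘ₗ LinearMap.adjoint Pr) v, v⟫ ≤ ⟪Sinv v, v⟫ ∧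
          ⟪Sinv v, v⟫ ≤ 𝒞 * γ * ⟪(Rop + Pr ∘ₗ 𝔅 ∘ₗ LinearMap.adjoint Pr) v, v⟫ := by
  have hlo : 0 < c₁ + c₄ * c₅ := by positivity
  have hup : 0 < 2 * (c₂ * c₇ + c₆ / c₃) := by positivity
  refine ⟨2 * (c₂ * c₇ + c₆ / c₃) * (c₁ + c₄ * c₅), mul_pos hup hlo, ?_⟩
  intro V W _ _ _ _ _ _ S Rop Rinv Sinv A 𝔅 Pr P ρ hρ hS hSpos hA hApos hR hRpos hB
    hRR_left hRR hSS_left hSS _ hSR hRρ hBlo hBup hPr hP hPapp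
  have hS0 := inner_map_self_nonneg_of_pos hSpos
  have hA0 := inner_map_self_nonneg_of_pos hApos
  have hR0 := inner_map_self_nonneg_of_pos hRpos
  have hSS' (v : V) : S (Sinv v) = v := LinearMap.congr_fun hSS v
  have hRR' (v : V) : Rop (Rinv v) = v := LinearMap.congr_fun hRR v
  have hRR'' (v : V) : Rinv (Rop v) = v := LinearMap.congr_fun hRR_left v
  have hXv (v : V) : ⟪(Rop + Pr ∘ₗ 𝔅 ∘ₗ LinearMap.adjoint Pr) v, v⟫ =
      ⟪Rop v, v⟫ + ⟪𝔅 (LinearMap.adjoint Pr v), LinearMap.adjoint Pr v⟫ := by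
    simp [inner_add_left, LinearMap.adjoint_inner_right]
  have hAsurj := LinearMap.surjective_of_inner_map_self_pos hApos
  refine ⟨?_, ?_, (c₁ + c₄ * c₅)⁻¹, inv_pos.mpr hlo, ?_⟩
  · intro x y
    simp only [LinearMap.add_apply, LinearMap.comp_apply, inner_add_left, inner_add_right]
    rw [hR x y, ← LinearMap.adjoint_inner_right Pr, ← LinearMap.adjoint_inner_left Pr, hB]
  · intro v hv
    obtain ⟨w, hw⟩ := hAsurj (LinearMap.adjoint Pr v)
    rw [hXv, ← hw]
    have := mul_nonneg hc₃.le (hA0 w)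
    linarith [hRpos v hv, hBlo w]
  · intro v
    obtain ⟨w, hw⟩ := hAsurj (LinearMap.adjoint Pr v)
    obtain ⟨z, rfl⟩ : ∃ z, S z = v := ⟨Sinv v, hSS' v⟩
    have hz : Sinv (S z) = z := LinearMap.congr_fun hSS_left z
    have hAw (u : W) : ⟪A w, u⟫ = ⟪S z, Pr u⟫ := by rw [hw, LinearMap.adjoint_inner_left]
    rw [hXv, ← hw, hz, real_inner_comm (S z) z]
    have hRop : ⟪Rop (S z), S z⟫ ≤ c₁ * ⟪S z, z⟫ := by
      rw [real_inner_comm]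
      refine hS.inner_le_of_inner_self_le_inner hS0 hc₁ ?_
      simpa [hRR''] using hSR (Rop (S z))
    have hAww : ⟪A w, w⟫ ≤ c₅ * ⟪S z, z⟫ := by
      rw [hAw]
      refine hS.inner_le_of_inner_self_le_inner hS0 hc₅ ?_
      rw [← hAw]
      exact hPr w
    have hsmooth : ⟪S z, z - Pr (P z)⟫ ≤ c₂ * c₇ * ⟪Rop (S z), S z⟫ + ⟪S z, z⟫ / 4 := by
      have h := hR.inner_le_of_inner_self_le hR0 (mul_pos hc₂ hc₇) (s := ⟪S z, z⟫)
        (x := S z) (y := Rinv (z - Pr (P z))) ?_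
      · rwa [hR, hRR'] at h
      · rw [hRR', real_inner_comm]
        calc _ ≤ c₂ * ρ * ‖z - Pr (P z)‖ ^ 2 := hRρ _
          _ ≤ c₂ * ρ * (c₇ * ρ⁻¹ * ⟪S z, z⟫) := by gcongr; exact hPapp z
          _ = c₂ * c₇ * ⟪S z, z⟫ := by field_simp
    have hcoarse : ⟪S z, Pr (P z)⟫ ≤ c₆ * ⟪A w, w⟫ + ⟪S z, z⟫ / 4 := by
      rw [← hAw]
      exact hA.inner_le_of_inner_self_le hA0 hc₆ (hP z)
    rw [inner_sub_right] at hsmooth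
    have hBw : ⟪A w, w⟫ ≤ ⟪𝔅 (A w), A w⟫ / c₃ := by
      rw [le_div_iff₀' hc₃]
      exact hBlo w
    have hB0 : 0 ≤ ⟪𝔅 (A w), A w⟫ := (mul_nonneg hc₃.le (hA0 w)).trans (hBlo w)
    constructor
    · rw [inv_mul_le_iff₀ hlo]
      linarith [hBup w, mul_le_mul_of_nonneg_left hAww hc₄.le]
    · rw [mul_assoc _ (c₁ + c₄ * c₅), mul_inv_cancel₀ hlo.ne', mul_one]
      have h₁ : c₆ * ⟪A w, w⟫ ≤ c₆ / c₃ * ⟪𝔅 (A w), A w⟫ := by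
        rw [div_mul_eq_mul_div, mul_div_assoc]
        gcongr
      have h₂ : 0 ≤ c₂ * c₇ * ⟪𝔅 (A w), A w⟫ := by positivity
      have h₃ : 0 ≤ c₆ / c₃ * ⟪Rop (S z), S z⟫ := mul_nonneg (by positivity) (hR0 _)
      linarith
end
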